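/- For every integer s ≥ 2 and every natural number k, the symmetric density σ_s satisfies ∫_{−√K}^{√K} x^{2k} σ_s(x) dx = (1/(sk+1)) · binomial((s+1)k, k), and ∫_{−√K}^{√K} x^{2k+1} σ_s(x) dx = 0. -/

import Mathlib

open MeasureTheory Real

noncomputable def eulerBeta (a b : ℝ) : ℝ := Real.Gamma a * Real.Gamma b / Real.Gamma (a + b)

noncomputable def Kc (s : ℕ) : ℝ := ((s : ℝ) + 1) ^ (s + 1) / (s : ℝ) ^ s

noncomputable def tauProd {s : ℕ} (t : Fin s → ℝ) : ℝ := ∏ i, t i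

def cube (s : ℕ) : Set (Fin s → ℝ) := Set.univ.pi fun _ => Set.Icc (0 : ℝ) 1

noncomputable def Cnorm (s : ℕ) : ℝ :=
  1 / (eulerBeta (1 / ((s : ℝ) + 1)) (((s : ℝ) - 1) / (2 * (s : ℝ) + 2)) *
      ∏ j ∈ Finset.Icc 2 s,
        eulerBeta ((j : ℝ) / ((s : ℝ) + 1)) ((j : ℝ) / ((s : ℝ) * ((s : ℝ) + 1))))

noncomputable def Fdens (s : ℕ) (t : Fin s → ℝ) : ℝ :=
  Cnorm s * ∏ i : Fin s,
    if (i : ℕ) = 0 then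
      t i ^ (1 / ((s : ℝ) + 1) - 1) * (1 - t i) ^ (((s : ℝ) - 1) / (2 * (s : ℝ) + 2) - 1)
    else
      t i ^ ((((i : ℕ) : ℝ) + 1) / ((s : ℝ) + 1) - 1) *
        (1 - t i) ^ ((((i : ℕ) : ℝ) + 1) / ((s : ℝ) * ((s : ℝ) + 1)) - 1)

noncomputable def sigmaDens (s : ℕ) (x : ℝ) : ℝ :=
  (1 / eulerBeta (1 / 2) (1 / 2 + 1 / (s : ℝ))) *
    ∫ t in cube s,
      if x ^ 2 ≤ tauProd t * Kc s then
        (tauProd t * Kc s - x ^ 2) ^ (1 / (s : ℝ) - 1 / 2) *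
          (tauProd t * Kc s) ^ (-(1 : ℝ) / (s : ℝ)) * Fdens s t
      else 0

lemma eulerBeta_pos' {a b : ℝ} (ha : 0 < a) (hb : 0 < b) : 0 < eulerBeta a b :=
  ProbabilityTheory.beta_pos ha hb

lemma beta_int {a b : ℝ} (ha : 0 < a) (hb : 0 < b) :
    ∫ x in Set.Icc (0:ℝ) 1, x ^ (a - 1) * (1 - x) ^ (b - 1) = eulerBeta a b := by
  have h := ProbabilityTheory.beta_eq_betaIntegralReal a b ha hb
  change eulerBeta a b = _ at h
  rw [h, integral_Icc_eq_integral_Ioc, Complex.betaIntegral,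
    intervalIntegral.integral_of_le (by norm_num), ← RCLike.re_to_complex, ← integral_re]
  · refine setIntegral_congr_fun measurableSet_Ioc fun x ⟨hx1, hx2⟩ ↦ ?_
    norm_cast
    rw [← Complex.ofReal_cpow, ← Complex.ofReal_cpow, RCLike.re_to_complex,
      Complex.re_mul_ofReal, Complex.ofReal_re]
    all_goals linarith
  · have := Complex.betaIntegral_convergent (u := a) (v := b) (by simpa) (by simpa)
    rwa [intervalIntegrable_iff_integrableOn_Ioc_of_le (by simp), IntegrableOn] at this

lemma inner_int {y b : ℝ} (hy : 0 < y) (hb : 0 < b) (k : ℕ) :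
    ∫ x : ℝ, (if x ^ 2 ≤ y then x ^ (2 * k) * (y - x ^ 2) ^ (b - 1) else 0) =
      y ^ ((k : ℝ) + b - 1 / 2) * eulerBeta (k + 1 / 2) b := by
  have hk : (0:ℝ) ≤ k := Nat.cast_nonneg k
  set g : ℝ → ℝ := fun v => if v ≤ y then v ^ ((k:ℝ) - 1 / 2) * (y - v) ^ (b - 1) else 0 with hg
  have e1 : ∫ x : ℝ, (if x ^ 2 ≤ y then x ^ (2 * k) * (y - x ^ 2) ^ (b - 1) else 0) =
      2 * ∫ x in Set.Ioi (0:ℝ), (if x ^ 2 ≤ y then x ^ (2 * k) * (y - x ^ 2) ^ (b - 1) else 0) := by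
    rw [← integral_comp_abs
      (f := fun x => if x ^ 2 ≤ y then x ^ (2 * k) * (y - x ^ 2) ^ (b - 1) else 0)]
    simp only [sq_abs, pow_mul]
  have e2 : 2 * ∫ x in Set.Ioi (0:ℝ), (if x ^ 2 ≤ y then x ^ (2 * k) * (y - x ^ 2) ^ (b - 1) else 0)
      = ∫ v in Set.Ioi (0:ℝ), g v := by
    rw [← integral_comp_rpow_Ioi_of_pos (g := g) (p := 2) (by norm_num), ← integral_const_mul]
    refine setIntegral_congr_fun measurableSet_Ioi fun x hx ↦ ?_
    have hx : 0 < x := hx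
    simp only [hg, smul_eq_mul]
    rw [Real.rpow_two]
    split_ifs
    · have : (x ^ 2) ^ ((k:ℝ) - 1 / 2) * x = x ^ (2 * k) := by
        rw [← Real.rpow_natCast x 2, ← Real.rpow_mul hx.le, ← Real.rpow_natCast x (2 * k)]
        nth_rewrite 2 [← Real.rpow_one x]
        rw [← Real.rpow_add hx]
        congr 1
        push_cast
        ring
      rw [← this]
      have : x ^ ((2:ℝ) - 1) = x := by norm_num
      rw [this]; ring
    · simp
  have e3 : ∫ v in Set.Ioi (0:ℝ), g v = y * ∫ v in Set.Ioi (0:ℝ), g (y * v) := by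
    have := integral_comp_mul_left_Ioi g 0 hy
    rw [this, mul_zero, smul_eq_mul, ← mul_assoc, mul_inv_cancel₀ hy.ne', one_mul]
  have e4 : ∫ v in Set.Ioi (0:ℝ), g (y * v) = ∫ v in Set.Ioc (0:ℝ) 1, g (y * v) := by
    refine (setIntegral_eq_of_subset_of_forall_sdiff_eq_zero measurableSet_Ioi
      (fun x hx => hx.1) fun x hx => ?_)
    have h0 : 0 < x := hx.1
    have h1 : 1 < x := by
      by_contra h
      exact hx.2 ⟨h0, not_lt.1 h⟩
    simp only [hg]
    rw [if_neg]
    nlinarith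
  have e5 : ∫ v in Set.Ioc (0:ℝ) 1, g (y * v) =
      y ^ ((k:ℝ) - 1 / 2 + (b - 1)) * eulerBeta (k + 1 / 2) b := by
    rw [← beta_int (by positivity) hb, ← integral_const_mul, integral_Icc_eq_integral_Ioc]
    refine setIntegral_congr_fun measurableSet_Ioc fun x ⟨hx1, hx2⟩ ↦ ?_
    simp only [hg]
    rw [if_pos (by nlinarith), Real.rpow_add hy, Real.mul_rpow hy.le hx1.le,
      show y - y * x = y * (1 - x) by ring, Real.mul_rpow hy.le (by linarith),
      show (k:ℝ) + 1 / 2 - 1 = k - 1 / 2 by ring]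
    ring
  rw [e1, e2, e3, e4, e5, ← mul_assoc]
  congr 1
  nth_rewrite 1 [← Real.rpow_one y]
  rw [← Real.rpow_add hy]
  congr 1; ring

/-- rising factorial -/
noncomputable def risingF (a : ℝ) (k : ℕ) : ℝ := ∏ i ∈ Finset.range k, (a + i)

lemma risingF_succ (a : ℝ) (k : ℕ) : risingF a (k + 1) = risingF a k * (a + k) :=
  Finset.prod_range_succ _ _

lemma risingF_pos {a : ℝ} (ha : 0 < a) (k : ℕ) : 0 < risingF a k :=
  Finset.prod_pos fun i _ => by positivity

lemma Gamma_add_nat {a : ℝ} (ha : 0 < a) (k : ℕ) :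
    Real.Gamma (a + k) = risingF a k * Real.Gamma a := by
  induction k with
  | zero => simp [risingF]
  | succ k ih =>
    rw [risingF_succ, Nat.cast_succ, ← add_assoc, Real.Gamma_add_one (by positivity), ih]; ring

lemma eulerBeta_add {a b : ℝ} (ha : 0 < a) (hb : 0 < b) (k : ℕ) :
    eulerBeta (a + k) b = eulerBeta a b * (risingF a k / risingF (a + b) k) := by
  unfold eulerBeta
  rw [show a + k + b = (a + b) + k by ring, Gamma_add_nat ha, Gamma_add_nat (by positivity)]
  have := (risingF_pos (add_pos ha hb) k).ne'
  have := (Real.Gamma_pos_of_pos (add_pos ha hb)).ne'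
  field_simp

lemma fact_mul (n : ℕ) (hn : 0 < n) (k : ℕ) :
    ((n * k).factorial : ℝ) = (n:ℝ) ^ (n * k) * ∏ i : Fin n, risingF (((i:ℕ):ℝ) / n + 1 / n) k := by
  have hn' : (n:ℝ) ≠ 0 := by positivity
  induction k with
  | zero => simp [risingF]
  | succ k ih =>
    simp_rw [risingF_succ]
    rw [Finset.prod_mul_distrib, mul_add, mul_one, pow_add,
      show (n:ℝ) ^ (n * k) * n ^ n * ((∏ i : Fin n, risingF (((i:ℕ):ℝ) / n + 1 / n) k) *
        ∏ i : Fin n, (((i:ℕ):ℝ) / n + 1 / n + k)) = ((n:ℝ) ^ (n * k) *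
        (∏ i : Fin n, risingF (((i:ℕ):ℝ) / n + 1 / n) k)) *
        (n ^ n * ∏ i : Fin n, (((i:ℕ):ℝ) / n + 1 / n + k)) by ring, ← ih,
      ← Nat.factorial_mul_ascFactorial, Nat.cast_mul]
    congr 1
    rw [Nat.ascFactorial_eq_prod_range, Nat.cast_prod, ← Fin.prod_univ_eq_prod_range
      (fun i => ((n * k + 1 + i : ℕ) : ℝ))]
    have : (n:ℝ) ^ n = ∏ i : Fin n, (n:ℝ) := by simp
    rw [this, ← Finset.prod_mul_distrib]
    refine Finset.prod_congr rfl fun i _ => ?_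
    push_cast
    field_simp
    ring

lemma prod_fin_Icc (f : ℕ → ℝ) (s : ℕ) (hs : 1 ≤ s) :
    ∏ i : Fin s, f (i + 1) = f 1 * ∏ j ∈ Finset.Icc 2 s, f j := by
  induction s, hs using Nat.le_induction with
  | base => simp
  | succ n hn ih =>
    rw [Fin.prod_univ_castSucc]
    simp only [Fin.val_castSucc, Fin.val_last]
    rw [ih, Finset.prod_Icc_succ_top (by omega), mul_assoc]

noncomputable def pa (s i : ℕ) : ℝ := ((i:ℝ) + 1) / ((s:ℝ) + 1)
noncomputable def pb (s i : ℕ) : ℝ :=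
  if i = 0 then ((s : ℝ) - 1) / (2 * (s : ℝ) + 2) else ((i:ℝ) + 1) / ((s : ℝ) * ((s : ℝ) + 1))

lemma pa_pos (s i : ℕ) : 0 < pa s i := by unfold pa; positivity
lemma pb_pos (s i : ℕ) (hs : 2 ≤ s) : 0 < pb s i := by
  have : (2:ℝ) ≤ s := by exact_mod_cast hs
  unfold pb
  split_ifs
  · apply div_pos <;> linarith
  · positivity

lemma Cnorm_eq (s : ℕ) (hs : 2 ≤ s) : Cnorm s = 1 / ∏ i : Fin s, eulerBeta (pa s i) (pb s i) := by
  unfold Cnorm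
  have := prod_fin_Icc (fun j => eulerBeta (pa s (j - 1)) (pb s (j - 1))) s (by omega)
  simp only [Nat.add_sub_cancel] at this
  rw [this]
  congr 2
  · simp [pa, pb]
  · refine Finset.prod_congr rfl fun j hj => ?_
    have hj := (Finset.mem_Icc.1 hj).1
    obtain ⟨j, rfl⟩ : ∃ m, j = m + 1 := ⟨j - 1, by omega⟩
    have : j ≠ 0 := by omega
    simp [pa, pb, this]

lemma Fdens_eq (s : ℕ) (t : Fin s → ℝ) : Fdens s t =
    Cnorm s * ∏ i : Fin s, (t i ^ (pa s i - 1) * (1 - t i) ^ (pb s i - 1)) := by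
  unfold Fdens
  congr 1
  refine Finset.prod_congr rfl fun i _ => ?_
  unfold pa pb
  split_ifs with h
  · simp [h]
  · rfl

lemma Cnorm_pos (s : ℕ) (hs : 2 ≤ s) : 0 < Cnorm s := by
  rw [Cnorm_eq s hs]
  exact one_div_pos.2 (Finset.prod_pos fun i _ => eulerBeta_pos' (pa_pos s i) (pb_pos s i hs))

lemma Fdens_nonneg (s : ℕ) (hs : 2 ≤ s) (t : Fin s → ℝ) (ht : t ∈ cube s) : 0 ≤ Fdens s t := by
  rw [Fdens_eq]
  refine mul_nonneg (Cnorm_pos s hs).le (Finset.prod_nonneg fun i _ => ?_)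
  have := ht i (Set.mem_univ i)
  exact mul_nonneg (Real.rpow_nonneg this.1 _) (Real.rpow_nonneg (by linarith [this.2]) _)

lemma Fdens_zero (s : ℕ) (t : Fin s → ℝ)
    (h : tauProd t = 0) : Fdens s t = 0 := by
  obtain ⟨i, -, hi⟩ := Finset.prod_eq_zero_iff.1 h
  rw [Fdens_eq, Finset.prod_eq_zero (Finset.mem_univ i), mul_zero]
  rw [hi, Real.zero_rpow, zero_mul]
  have : pa s i < 1 := by
    unfold pa
    rw [div_lt_one (by positivity)]
    have := i.2
    have : ((i:ℕ):ℝ) < s := by exact_mod_cast this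
    linarith
  linarith

lemma comb (s : ℕ) (hs : 2 ≤ s) (k : ℕ) :
    risingF (1 / 2) k / risingF (1 / 2 + (1 / 2 + 1 / (s:ℝ))) k * (Kc s ^ k *
      ∏ i : Fin s, (risingF (pa s i) k / risingF (pa s i + pb s i) k)) =
      (1 / ((s : ℝ) * k + 1)) * (((s + 1) * k).choose k) := by
  have hs0 : (0:ℝ) < s := by positivity
  have h1 := fact_mul (s + 1) (by omega) k
  have h2 := fact_mul s (by omega) k
  -- split the factor `i = 0` of the denominators
  have hden : (∏ i : Fin s, risingF (pa s i + pb s i) k) * risingF (1 / (s:ℝ)) k =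
      risingF (1 / 2) k * ∏ i : Fin s, risingF (((i:ℕ):ℝ) / s + 1 / s) k := by
    have a1 := prod_fin_Icc (fun j => risingF (pa s (j - 1) + pb s (j - 1)) k) s (by omega)
    have a2 := prod_fin_Icc (fun j => risingF (((j - 1 : ℕ):ℝ) / s + 1 / s) k) s (by omega)
    simp only [Nat.add_sub_cancel] at a1 a2
    have a3 : ∏ j ∈ Finset.Icc 2 s, risingF (pa s (j - 1) + pb s (j - 1)) k =
        ∏ j ∈ Finset.Icc 2 s, risingF (((j - 1 : ℕ):ℝ) / s + 1 / s) k := by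
      refine Finset.prod_congr rfl fun j hj => ?_
      have hj := (Finset.mem_Icc.1 hj).1
      have hj' : j - 1 ≠ 0 := by omega
      congr 1
      unfold pa pb
      rw [if_neg hj']
      field_simp
    have a4 : pa s 0 + pb s 0 = 1 / 2 := by
      unfold pa pb
      rw [if_pos rfl]
      push_cast
      field_simp
      ring
    rw [a1, a2, a3]
    simp only [Nat.sub_self, a4]
    norm_num
    ring
  have hnum : ∏ i : Fin (s + 1), risingF (((i:ℕ):ℝ) / ((s + 1 : ℕ):ℝ) + 1 / ((s + 1 : ℕ):ℝ)) k =
      (∏ i : Fin s, risingF (pa s i) k) * k.factorial := by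
    rw [Fin.prod_univ_castSucc]
    congr 1
    · refine Finset.prod_congr rfl fun i _ => ?_
      congr 1
      unfold pa
      push_cast
      simp only [Fin.val_castSucc]
      ring
    · have : (((Fin.last s : Fin (s+1)) : ℕ) : ℝ) / ((s + 1 : ℕ):ℝ) + 1 / ((s + 1 : ℕ):ℝ) = 1 := by
        simp only [Fin.val_last]
        push_cast
        field_simp
      rw [this]
      have := Gamma_add_nat one_pos k
      rw [Real.Gamma_one, mul_one, add_comm, Real.Gamma_nat_eq_factorial] at this
      exact this.symm
  have hshift : risingF (1 / 2 + (1 / 2 + 1 / (s:ℝ))) k = risingF (1 / (s:ℝ)) k * (s * k + 1) := by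
    have b1 : risingF (1 / (s:ℝ)) (k + 1) = (1 / s) * risingF (1 / 2 + (1 / 2 + 1 / (s:ℝ))) k := by
      unfold risingF
      rw [Finset.prod_range_succ']
      rw [mul_comm]
      congr 1
      · simp
      · refine Finset.prod_congr rfl fun i _ => ?_
        push_cast; ring
    rw [risingF_succ] at b1
    field_simp at b1 ⊢
    linarith
  have hch : (((s + 1) * k).choose k : ℝ) = ((s + 1) * k).factorial / (k.factorial * (s * k).factorial) := by
    rw [Nat.cast_choose ℝ (by nlinarith : k ≤ (s + 1) * k)]
    congr 4
    rw [add_mul, one_mul, Nat.add_sub_cancel]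
  rw [hch, h1, h2, hnum, hshift, Finset.prod_div_distrib]
  have p1 : risingF (1 / 2) k ≠ 0 := (risingF_pos (by norm_num) k).ne'
  have p2 : risingF (1 / (s:ℝ)) k ≠ 0 := (risingF_pos (by positivity) k).ne'
  have p3 : ∏ i : Fin s, risingF (pa s i + pb s i) k ≠ 0 :=
    Finset.prod_ne_zero_iff.2 fun i _ => (risingF_pos (add_pos (pa_pos s i) (pb_pos s i hs)) k).ne'
  have p4 : ∏ i : Fin s, risingF (((i:ℕ):ℝ) / s + 1 / s) k ≠ 0 :=
    Finset.prod_ne_zero_iff.2 fun i _ => (risingF_pos (by positivity) k).ne'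
  have p5 : (k.factorial : ℝ) ≠ 0 := by positivity
  have p6 : (s:ℝ) * k + 1 ≠ 0 := by positivity
  have hK : Kc s ^ k = ((s + 1 : ℕ):ℝ) ^ ((s + 1) * k) / (s:ℝ) ^ (s * k) := by
    unfold Kc
    rw [div_pow, ← pow_mul, ← pow_mul]
    push_cast; rfl
  rw [hK]
  generalize (∏ i : Fin s, risingF (pa s i + pb s i) k) = A at *
  generalize (∏ i : Fin s, risingF (((i:ℕ):ℝ) / s + 1 / s) k) = D at *
  generalize (∏ i : Fin s, risingF (pa s i) k) = N at *
  generalize risingF (1 / 2) k = X at *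
  generalize risingF (1 / (s:ℝ)) k = Y at *
  have hA : A = X * D / Y := by field_simp; linarith
  rw [hA]
  field_simp

lemma Fdens_meas (s : ℕ) : Measurable (Fdens s) := by
  have : Fdens s = fun t => Cnorm s *
      ∏ i : Fin s, (t i ^ (pa s i - 1) * (1 - t i) ^ (pb s i - 1)) := funext (Fdens_eq s)
  rw [this]
  fun_prop

lemma tauProd_meas (s : ℕ) : Measurable (fun t : Fin s → ℝ => tauProd t) := by
  unfold tauProd
  fun_prop

lemma Kc_pos (s : ℕ) (hs : 2 ≤ s) : 0 < Kc s := by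
  unfold Kc
  positivity

/-- the joint integrand -/
noncomputable def Gj (s k : ℕ) (x : ℝ) (t : Fin s → ℝ) : ℝ :=
  x ^ (2 * k) * (if x ^ 2 ≤ tauProd t * Kc s then
        (tauProd t * Kc s - x ^ 2) ^ (1 / (s : ℝ) - 1 / 2) *
          (tauProd t * Kc s) ^ (-(1 : ℝ) / (s : ℝ)) * Fdens s t
      else 0)

lemma Gj_meas (s k : ℕ) : Measurable (Function.uncurry (Gj s k)) := by
  change Measurable (fun p : ℝ × (Fin s → ℝ) => Gj s k p.1 p.2)
  unfold Gj
  have h1 := (Fdens_meas s).comp (measurable_snd : Measurable (Prod.snd : ℝ × (Fin s → ℝ) → _))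
  have h2 := (tauProd_meas s).comp (measurable_snd : Measurable (Prod.snd : ℝ × (Fin s → ℝ) → _))
  simp only [Function.comp_def] at h1 h2
  refine Measurable.mul (by fun_prop) (Measurable.ite (measurableSet_le (by fun_prop) (by fun_prop))
    ?_ measurable_const)
  fun_prop

lemma tau_mem {s : ℕ} {t : Fin s → ℝ} (ht : t ∈ cube s) : 0 ≤ tauProd t ∧ tauProd t ≤ 1 :=
  ⟨Finset.prod_nonneg fun i _ => (ht i (Set.mem_univ i)).1,
    Finset.prod_le_one (fun i _ => (ht i (Set.mem_univ i)).1)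
      fun i _ => (ht i (Set.mem_univ i)).2⟩

lemma Gj_nonneg (s k : ℕ) (hs : 2 ≤ s) (x : ℝ) (t : Fin s → ℝ) (ht : t ∈ cube s) :
    0 ≤ Gj s k x t := by
  unfold Gj
  refine mul_nonneg (by rw [pow_mul]; positivity) ?_
  split_ifs with h
  · exact mul_nonneg (mul_nonneg (Real.rpow_nonneg (by linarith) _)
      (Real.rpow_nonneg (by nlinarith) _)) (Fdens_nonneg s hs t ht)
  · exact le_rfl

lemma Gj_inner (s k : ℕ) (hs : 2 ≤ s) (t : Fin s → ℝ) (ht : t ∈ cube s) :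
    Integrable (fun x => Gj s k x t) ∧
    ∫ x, Gj s k x t = eulerBeta (k + 1 / 2) (1 / 2 + 1 / (s:ℝ)) * Kc s ^ k *
      (tauProd t ^ k * Fdens s t) := by
  rcases (tau_mem ht).1.eq_or_lt with h0 | h0
  · have := Fdens_zero s t h0.symm
    simp [Gj, this]
  · have hK := Kc_pos s hs
    set y := tauProd t * Kc s with hy
    have hy0 : 0 < y := mul_pos h0 hK
    have hb : 0 < 1 / 2 + 1 / (s:ℝ) := by positivity
    have e := inner_int hy0 hb k
    have hpos : 0 < y ^ ((k : ℝ) + (1 / 2 + 1 / (s:ℝ)) - 1 / 2) *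
        eulerBeta (k + 1 / 2) (1 / 2 + 1 / (s:ℝ)) :=
      mul_pos (Real.rpow_pos_of_pos hy0 _) (eulerBeta_pos' (by positivity) hb)
    have hi := Integrable.of_integral_ne_zero (e ▸ hpos.ne')
    have hG : (fun x => Gj s k x t) = fun x => (if x ^ 2 ≤ y then x ^ (2 * k) *
        (y - x ^ 2) ^ ((1 / 2 + 1 / (s:ℝ)) - 1) else 0) * (y ^ (-(1 : ℝ) / (s : ℝ)) * Fdens s t) := by
      funext x
      unfold Gj
      rw [← hy, show (1 / 2 + 1 / (s:ℝ)) - 1 = 1 / (s:ℝ) - 1 / 2 by ring]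
      split_ifs
      · ring
      · ring
    rw [hG]
    refine ⟨hi.mul_const _, ?_⟩
    rw [integral_mul_const, e]
    have : y ^ ((k : ℝ) + (1 / 2 + 1 / (s:ℝ)) - 1 / 2) * y ^ (-(1 : ℝ) / (s : ℝ)) = y ^ k := by
      rw [← Real.rpow_add hy0, ← Real.rpow_natCast]
      congr 1
      ring
    calc _ = (y ^ ((k : ℝ) + (1 / 2 + 1 / (s:ℝ)) - 1 / 2) * y ^ (-(1 : ℝ) / (s : ℝ))) *
          eulerBeta (k + 1 / 2) (1 / 2 + 1 / (s:ℝ)) * Fdens s t := by ring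
      _ = _ := by rw [this, hy, mul_pow]; ring

lemma outer (s k : ℕ) (hs : 2 ≤ s) :
    ∫ t in cube s, tauProd t ^ k * Fdens s t =
      ∏ i : Fin s, (risingF (pa s i) k / risingF (pa s i + pb s i) k) := by
  have hm : (volume : Measure (Fin s → ℝ)).restrict (cube s) =
      Measure.pi fun _ : Fin s => (volume : Measure ℝ).restrict (Set.Icc 0 1) := by
    rw [volume_pi]
    exact Measure.restrict_pi_pi _ _
  have e1 : ∫ t in cube s, tauProd t ^ k * Fdens s t =
      ∫ t in cube s, Cnorm s * ∏ i : Fin s,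
        (t i ^ (pa s i + k - 1) * (1 - t i) ^ (pb s i - 1)) := by
    refine setIntegral_congr_fun (MeasurableSet.univ_pi fun _ => measurableSet_Icc) fun t ht => ?_
    simp only [Fdens_eq]
    rw [mul_left_comm, tauProd, ← Finset.prod_pow, ← Finset.prod_mul_distrib]
    congr 1
    refine Finset.prod_congr rfl fun i _ => ?_
    rw [← mul_assoc]
    congr 1
    rcases (ht i (Set.mem_univ i)).1.eq_or_lt with h | h
    · rw [← h]
      rcases Nat.eq_zero_or_pos k with rfl | hk
      · simp
      · have : (1:ℝ) ≤ k := by exact_mod_cast hk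
        have := pa_pos s i
        rw [zero_pow hk.ne', zero_mul, Real.zero_rpow (by linarith)]
    · rw [← Real.rpow_natCast, ← Real.rpow_add h]
      congr 1
      ring
  rw [e1, integral_const_mul, hm, integral_fintype_prod_eq_prod
    (f := fun (i : Fin s) (u : ℝ) => u ^ (pa s i + k - 1) * (1 - u) ^ (pb s i - 1))]
  have e2 : ∀ i : Fin s, ∫ u in Set.Icc (0:ℝ) 1, u ^ (pa s i + k - 1) * (1 - u) ^ (pb s i - 1) =
      eulerBeta (pa s i) (pb s i) * (risingF (pa s i) k / risingF (pa s i + pb s i) k) := fun i => by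
    rw [beta_int (add_pos_of_pos_of_nonneg (pa_pos s i) (Nat.cast_nonneg k)) (pb_pos s i hs),
      eulerBeta_add (pa_pos s i) (pb_pos s i hs)]
  simp_rw [e2]
  rw [Finset.prod_mul_distrib, Cnorm_eq s hs, ← mul_assoc, one_div_mul_cancel, one_mul]
  exact Finset.prod_ne_zero_iff.2 fun i _ => (eulerBeta_pos' (pa_pos s i) (pb_pos s i hs)).ne'

lemma sigma_even (s : ℕ) (x : ℝ) : sigmaDens s (-x) = sigmaDens s x := by
  simp [sigmaDens]

lemma sigma_zero (s : ℕ) (hs : 2 ≤ s) (x : ℝ) (hx : Kc s < x ^ 2) : sigmaDens s x = 0 := by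
  unfold sigmaDens
  rw [setIntegral_eq_zero_of_forall_eq_zero, mul_zero]
  intro t ht
  rw [if_neg]
  have := tau_mem ht
  nlinarith [Kc_pos s hs]

/-- For every integer `s ≥ 2` and every natural number `k`, the symmetric
density `σ_s` has even moments given by the Fuss–Catalan numbers and vanishing odd moments. -/
theorem moments_of_sigmaDens (s : ℕ) (hs : 2 ≤ s) (k : ℕ) :
    (∫ x in -Real.sqrt (Kc s)..Real.sqrt (Kc s), x ^ (2 * k) * sigmaDens s x =
      (1 / ((s : ℝ) * k + 1)) * (((s + 1) * k).choose k)) ∧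
    ∫ x in -Real.sqrt (Kc s)..Real.sqrt (Kc s), x ^ (2 * k + 1) * sigmaDens s x = 0 := by
  constructor
  · have hK := Kc_pos s hs
    have hc0 : 0 < eulerBeta (1 / 2) (1 / 2 + 1 / (s:ℝ)) :=
      eulerBeta_pos' (by norm_num) (by positivity)
    have hcube : MeasurableSet (cube s) := MeasurableSet.univ_pi fun _ => measurableSet_Icc
    have e1 : ∫ x in -Real.sqrt (Kc s)..Real.sqrt (Kc s), x ^ (2 * k) * sigmaDens s x =
        ∫ x, x ^ (2 * k) * sigmaDens s x := by
      rw [intervalIntegral.integral_of_le (by linarith [Real.sqrt_nonneg (Kc s)]),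
        ← integral_Icc_eq_integral_Ioc]
      refine setIntegral_eq_integral_of_forall_compl_eq_zero fun x hx => ?_
      rw [sigma_zero s hs, mul_zero]
      by_contra h
      exact hx (Set.mem_Icc.2 (abs_le.1 (Real.abs_le_sqrt (not_lt.1 h))))
    have e2 : ∀ x, x ^ (2 * k) * sigmaDens s x =
        (1 / eulerBeta (1 / 2) (1 / 2 + 1 / (s : ℝ))) * ∫ t in cube s, Gj s k x t := fun x => by
      unfold sigmaDens Gj
      rw [integral_const_mul]
      ring
    have hcomb := comb s hs k
    have hout := outer s k hs
    have hint : IntegrableOn (fun t : Fin s → ℝ => tauProd t ^ k * Fdens s t) (cube s) := by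
      refine Integrable.of_integral_ne_zero ?_
      rw [hout]
      exact Finset.prod_ne_zero_iff.2 fun i _ => (div_pos (risingF_pos (pa_pos s i) k)
        (risingF_pos (add_pos (pa_pos s i) (pb_pos s i hs)) k)).ne'
    have hGi : Integrable (Function.uncurry (Gj s k))
        ((volume : Measure ℝ).prod ((volume : Measure (Fin s → ℝ)).restrict (cube s))) := by
      rw [integrable_prod_iff' (Gj_meas s k).aestronglyMeasurable]
      refine ⟨ae_restrict_of_forall_mem hcube fun t ht => (Gj_inner s k hs t ht).1, ?_⟩
      refine (hint.const_mul
        (eulerBeta (k + 1 / 2) (1 / 2 + 1 / (s:ℝ)) * Kc s ^ k)).congr ?_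
      refine ae_restrict_of_forall_mem hcube fun t ht => ?_
      beta_reduce
      rw [← (Gj_inner s k hs t ht).2]
      refine integral_congr_ae (Filter.Eventually.of_forall fun x => ?_)
      exact (Real.norm_of_nonneg (Gj_nonneg s k hs x t ht)).symm
    rw [e1, integral_congr_ae (Filter.Eventually.of_forall e2), integral_const_mul,
      integral_integral_swap hGi,
      setIntegral_congr_fun hcube (fun t ht => (Gj_inner s k hs t ht).2),
      integral_const_mul, hout, ← hcomb, add_comm (k:ℝ) (1 / 2),
      eulerBeta_add (by norm_num) (by positivity)]
    generalize eulerBeta (1 / 2) (1 / 2 + 1 / (s:ℝ)) = E at hc0 ⊢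
    have := hc0.ne'
    generalize risingF (1 / 2 + (1 / 2 + 1 / (s:ℝ))) k = R
    field_simp
  · have h := intervalIntegral.integral_comp_neg (a := -Real.sqrt (Kc s)) (b := Real.sqrt (Kc s))
      (fun x => x ^ (2 * k + 1) * sigmaDens s x)
    simp only [sigma_even, neg_neg, Odd.neg_pow (⟨k, rfl⟩ : Odd (2 * k + 1)), neg_mul,
      intervalIntegral.integral_neg] at h
    linarith
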